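/- Let X ⊆ ℝ^n be closed with nonempty interior, Y ⊆ ℝ^m nonempty and open, Φ : X × Y → ℝ continuous relative to X × Y and continuously differentiable on int(X) × Y, and let g satisfy Assumption (G). Suppose g is finite at x̄ ∈ int X, (∂_Φ g)^{-1}(ȳ) = {x̄} for some ȳ ∈ Y, and the generalized proximal mapping (∂_Φ g)^{-1} is single-valued in a neighborhood of ȳ. Then the Φ-conjugate g^Φ(y) = sup_{x ∈ X} (Φ(x,y) − g(x)) is continuously differentiable in a neighborhood of ȳ, with ∇g^Φ(y) = ∇_y Φ((∂_Φ g)^{-1}(y), y) for all y near ȳ. -/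

import Mathlib

set_option linter.unusedVariables false

open Filter Topology Metric Set Bornology
open scoped RealInnerProductSpace NNReal

noncomputable section

variable {E F : Type*} [NormedAddCommGroup E] [InnerProductSpace ℝ E] [CompleteSpace E]
  [NormedAddCommGroup F] [InnerProductSpace ℝ F] [CompleteSpace F]

/-- Gradient of the coupling `Φ` in its first argument. -/
def gradx (Φ : E → F → ℝ) (x : E) (y : F) : E :=
  gradient (fun x' => Φ x' y) x

/-- Gradient of the coupling `Φ` in its second argument. -/
def grady (Φ : E → F → ℝ) (x : E) (y : F) : F :=
  gradient (fun y' => Φ x y') y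

/-- The Φ-conjugate of `f` relative to `X`: `f^Φ(y) = sup_{x ∈ X} (Φ(x,y) − f(x))`. -/
def phiConj (X : Set E) (Φ : E → F → ℝ) (f : E → EReal) (y : F) : EReal :=
  ⨆ x ∈ X, ((Φ x y : EReal) - f x)

/-- The Φ-biconjugate of `f`: `f^{ΦΦ}(x) = sup_{y ∈ Y} (Φ(x,y) − f^Φ(y))`. -/
def phiBiconj (X : Set E) (Y : Set F) (Φ : E → F → ℝ) (f : E → EReal) (x : E) : EReal :=
  ⨆ y ∈ Y, ((Φ x y : EReal) - phiConj X Φ f y)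

/-- `f` is Φ-convex on `X`: `f` is a pointwise supremum over `X` of functions
`x ↦ Φ(x, yᵢ) − βᵢ` with `yᵢ ∈ Y` (the empty index set giving `f ≡ −∞`). -/
def PhiConvexOn (X : Set E) (Y : Set F) (Φ : E → F → ℝ) (f : E → EReal) : Prop :=
  ∃ (ι : Type) (yi : ι → F) (βi : ι → EReal),
    (∀ i, yi i ∈ Y) ∧ ∀ x ∈ X, f x = ⨆ i, ((Φ x (yi i) : EReal) - βi i)

/-- The Φ-subdifferential of `f` at `xb`:
`y ∈ ∂_Φ f(xb)` iff `y ∈ Y` and `f(x) ≥ f(xb) + Φ(x,y) − Φ(xb,y)` for all `x ∈ X`. -/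
def phiSubdiff (X : Set E) (Y : Set F) (Φ : E → F → ℝ) (f : E → EReal) (xb : E) : Set F :=
  {y | y ∈ Y ∧ ∀ x ∈ X, f xb + ((Φ x y - Φ xb y : ℝ) : EReal) ≤ f x}

/-- The Φ-subdifferential of a function `gc` on `Y` (such as `f^Φ`) at `yb`:
`x ∈ ∂_Φ gc(yb)` iff `x ∈ X` and `gc(y) ≥ gc(yb) + Φ(x,y) − Φ(x,yb)` for all `y ∈ Y`. -/
def phiSubdiffDual (X : Set E) (Y : Set F) (Φ : E → F → ℝ) (gc : F → EReal) (yb : F) : Set E :=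
  {x | x ∈ X ∧ ∀ y ∈ Y, gc yb + ((Φ x y - Φ x yb : ℝ) : EReal) ≤ gc y}

/-- The generalized proximal mapping `(∂_Φ g)^{-1}(y) = argmin_{x ∈ X} (g(x) − Φ(x,y))`. -/
def proxSet (X : Set E) (Φ : E → F → ℝ) (g : E → EReal) (y : F) : Set E :=
  {x | x ∈ X ∧ ∀ x' ∈ X, g x - ((Φ x y : ℝ) : EReal) ≤ g x' - ((Φ x' y : ℝ) : EReal)}

/-- Assumption (G): `g` is proper and lsc on `X`, `g − Φ(·,y)` is level-bounded in `x`
locally uniformly in `y`, and the range of the generalized proximal mapping lies in `int X`. -/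
structure AssumptionG (X : Set E) (Y : Set F) (Φ : E → F → ℝ) (g : E → EReal) : Prop where
  proper : ∃ x ∈ X, g x ≠ ⊤
  ne_bot : ∀ x, g x ≠ ⊥
  lsc : LowerSemicontinuousOn g X
  levelBounded : ∀ yb ∈ Y, ∀ α : ℝ, ∃ V ∈ 𝓝 yb, ∃ B : Set E, IsBounded B ∧
    ∀ y ∈ V ∩ Y, {x | x ∈ X ∧ g x - ((Φ x y : ℝ) : EReal) ≤ (α : EReal)} ⊆ B
  ran_interior : ∀ y ∈ Y, proxSet X Φ g y ⊆ interior X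

/-- `v` is a regular (Fréchet) subgradient of `f` at `x`. -/
def IsFSubgrad (f : E → EReal) (x v : E) : Prop :=
  f x ≠ ⊤ ∧ f x ≠ ⊥ ∧ ∀ ε > (0 : ℝ), ∃ δ > (0 : ℝ), ∀ x', ‖x' - x‖ < δ →
    f x + ((⟪v, x' - x⟫ - ε * ‖x' - x‖ : ℝ) : EReal) ≤ f x'

/-- `v` is a limiting (Mordukhovich) subgradient of `f` at `x`. -/
def IsLSubgrad (f : E → EReal) (x v : E) : Prop :=
  f x ≠ ⊤ ∧ f x ≠ ⊥ ∧ ∃ xs vs : ℕ → E,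
    Tendsto xs atTop (𝓝 x) ∧ Tendsto (fun ν => f (xs ν)) atTop (𝓝 (f x)) ∧
    Tendsto vs atTop (𝓝 v) ∧ ∀ ν, IsFSubgrad f (xs ν) (vs ν)

/-- `f` is locally lower semicontinuous at `xb`. -/
def LocallyLscAt (f : E → EReal) (xb : E) : Prop :=
  ∃ ε > (0 : ℝ), ∀ α : EReal, α ≤ f xb + ((ε : ℝ) : EReal) →
    IsClosed {x | x ∈ closedBall xb ε ∧ f x ≤ α}

/-- `g` is prox-regular at `xb` for `vb` with parameter `r`. -/
def ProxRegularAt (g : E → EReal) (xb vb : E) (r : ℝ) : Prop :=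
  g xb ≠ ⊤ ∧ g xb ≠ ⊥ ∧ LocallyLscAt g xb ∧ IsLSubgrad g xb vb ∧
  ∃ ε > (0 : ℝ), ∀ x x' v : E, ‖x' - xb‖ ≤ ε → ‖x - xb‖ ≤ ε →
    g x ≤ g xb + ((ε : ℝ) : EReal) → IsLSubgrad g x v → ‖v - vb‖ ≤ ε →
    g x + ((⟪v, x' - x⟫ - r / 2 * ‖x' - x‖ ^ 2 : ℝ) : EReal) ≤ g x'

/-- `g` is Φ-prox-regular at `xb` for `(vb, yb)`. -/
def PhiProxRegularAt (X : Set E) (Φ : E → F → ℝ) (g : E → EReal)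
    (xb vb : E) (yb : F) : Prop :=
  g xb ≠ ⊤ ∧ g xb ≠ ⊥ ∧ LocallyLscAt g xb ∧ IsLSubgrad g xb vb ∧
  ∃ ε > (0 : ℝ), ∀ (x x' v : E) (y : F), ‖x' - xb‖ ≤ ε → ‖x - xb‖ ≤ ε →
    g x - g xb ≤ ((ε : ℝ) : EReal) → IsLSubgrad g x v → ‖v - vb‖ ≤ ε → ‖y - yb‖ ≤ ε →
    v = gradx Φ x y →
    g x + ((Φ x' y - Φ x y : ℝ) : EReal) ≤ g x'

/-- `g` is Φ-prox-regular at `xb` for `(vb, yb)` with the subgradient inequality strict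
whenever `x' ≠ x`. -/
def PhiProxRegularStrictAt (X : Set E) (Φ : E → F → ℝ) (g : E → EReal)
    (xb vb : E) (yb : F) : Prop :=
  PhiProxRegularAt X Φ g xb vb yb ∧
  ∃ ε > (0 : ℝ), ∀ (x x' v : E) (y : F), ‖x' - xb‖ ≤ ε → ‖x - xb‖ ≤ ε →
    g x - g xb ≤ ((ε : ℝ) : EReal) → IsLSubgrad g x v → ‖v - vb‖ ≤ ε → ‖y - yb‖ ≤ ε →
    v = gradx Φ x y → x' ≠ x →
    g x + ((Φ x' y - Φ x y : ℝ) : EReal) < g x'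

/-- The `g`-attentive `ε`-localization of the limiting subdifferential `∂g` at `xb` for `vb`. -/
def gAttentiveLoc (g : E → EReal) (xb vb : E) (ε : ℝ) (x : E) : Set E :=
  {v | ‖x - xb‖ < ε ∧ g x < g xb + ((ε : ℝ) : EReal) ∧ IsLSubgrad g x v ∧ ‖v - vb‖ < ε}

/-- `Φ` is twist: for each `x ∈ int X` the map `y ↦ ∇ₓΦ(x,y)` is injective on `Y`. -/
def IsTwist (X : Set E) (Y : Set F) (Φ : E → F → ℝ) : Prop :=
  ∀ x ∈ interior X, Set.InjOn (fun y => gradx Φ x y) Y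

/-- `Φ` is a local strong twist at `(xb, yb)`: with `vb := ∇ₓΦ(xb,yb)` there is a unique
continuously differentiable map `G(x,v)` near `(xb,vb)`, with values in `Y`, such that
`G(xb,vb) = yb` and `∇ₓΦ(x, G(x,v)) = v` near `(xb,vb)`. -/
def IsLocalStrongTwist (Y : Set F) (Φ : E → F → ℝ) (xb : E) (yb : F) : Prop :=
  ∃ (G : E × E → F) (U : Set (E × E)), IsOpen U ∧ (xb, gradx Φ xb yb) ∈ U ∧
    ContDiffOn ℝ 1 G U ∧ G (xb, gradx Φ xb yb) = yb ∧ (∀ p ∈ U, G p ∈ Y) ∧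
    (∀ p ∈ U, gradx Φ p.1 (G p) = p.2) ∧
    ∀ (G' : E × E → F) (U' : Set (E × E)), IsOpen U' → (xb, gradx Φ xb yb) ∈ U' →
      ContDiffOn ℝ 1 G' U' → G' (xb, gradx Φ xb yb) = yb → (∀ p ∈ U', G' p ∈ Y) →
      (∀ p ∈ U', gradx Φ p.1 (G' p) = p.2) →
      ∀ᶠ p in 𝓝 (xb, gradx Φ xb yb), G' p = G p

/-- `Φ` is a global strong twist. -/
def IsGlobalStrongTwist (X : Set E) (Y : Set F) (Φ : E → F → ℝ) : Prop :=
  IsTwist X Y Φ ∧ ∀ xb ∈ interior X, ∀ yb ∈ Y, IsLocalStrongTwist Y Φ xb yb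

/-- `σ` is a single-valued localization of the set-valued map `Fm` around `pb` for `qb`,
with domain of localization `U`. -/
def IsSVLocalization {α β : Type*} [TopologicalSpace α] [TopologicalSpace β]
    (Fm : α → Set β) (pb : α) (qb : β) (σ : α → β) (U : Set α) : Prop :=
  U ∈ 𝓝 pb ∧ σ pb = qb ∧ ∃ V ∈ 𝓝 qb, ∀ p ∈ U, Fm p ∩ V = {σ p}

/-- `H` is a first-order approximation to `Fm` at `xb`. -/
def IsFOApprox {α β : Type*} [NormedAddCommGroup α] [NormedAddCommGroup β]
    (Fm H : α → β) (xb : α) : Prop :=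
  H xb = Fm xb ∧ ∀ ε > (0 : ℝ), ∃ V ∈ 𝓝 xb, ∀ x ∈ V, ‖Fm x - H x‖ ≤ ε * ‖x - xb‖

/-- `H` is a strict first-order approximation to `Fm` at `xb`. -/
def IsStrictFOApprox {α β : Type*} [NormedAddCommGroup α] [NormedAddCommGroup β]
    (Fm H : α → β) (xb : α) : Prop :=
  H xb = Fm xb ∧ ∀ ε > (0 : ℝ), ∃ V ∈ 𝓝 xb, ∀ x ∈ V, ∀ x' ∈ V,
    ‖Fm x - H x - (Fm x' - H x')‖ ≤ ε * ‖x - x'‖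

/-- Sequential epi-convergence of `fs` to `f`. -/
def EpiConvergesSeq (fs : ℕ → E → EReal) (f : E → EReal) : Prop :=
  ∀ w : E,
    (∀ ws : ℕ → E, Tendsto ws atTop (𝓝 w) →
      f w ≤ Filter.liminf (fun ν => fs ν (ws ν)) atTop) ∧
    (∃ ws : ℕ → E, Tendsto ws atTop (𝓝 w) ∧
      Filter.limsup (fun ν => fs ν (ws ν)) atTop ≤ f w)

/-- `g` is strictly twice epi-differentiable at `xb` for `vb`: the second-order difference
quotients epi-converge to a common limit along every sequence `tₙ ↘ 0`,
`(xₙ, vₙ) → (xb, vb)` with `vₙ ∈ ∂g(xₙ)` and `g(xₙ) → g(xb)`. -/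
def StrictTwiceEpiDiff (g : E → EReal) (xb vb : E) : Prop :=
  ∃ h : E → EReal, ∀ (ts : ℕ → ℝ) (xs vs : ℕ → E),
    (∀ ν, 0 < ts ν) → Tendsto ts atTop (𝓝 0) →
    Tendsto xs atTop (𝓝 xb) → Tendsto vs atTop (𝓝 vb) →
    (∀ ν, IsLSubgrad g (xs ν) (vs ν)) →
    Tendsto (fun ν => g (xs ν)) atTop (𝓝 (g xb)) →
    EpiConvergesSeq (fun ν w =>
      ((2 / (ts ν) ^ 2 : ℝ) : EReal) *
        (g (xs ν + ts ν • w) - g (xs ν) - ((ts ν * ⟪vs ν, w⟫ : ℝ) : EReal))) h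

/-- `g` is prox-bounded with threshold `lamg`. -/
def ProxBoundedWith (g : E → EReal) (lamg : ℝ) : Prop :=
  ∀ lam : ℝ, 0 < lam → lam < lamg → ∃ (y : E) (b : ℝ), ∀ x : E,
    (b : EReal) ≤ g x + ((1 / (2 * lam) * ‖x - y‖ ^ 2 : ℝ) : EReal)

/-- `φ` is lower-C¹ on the open set `O`: locally a max over a compact index set `Z`
of functions `h(x, ·)` that are continuous in `(x,y)` together with their `y`-gradients. -/
def LowerC1On (φ : F → ℝ) (O : Set F) : Prop :=
  ∀ y₀ ∈ O, ∃ (V : Set F) (Z : Set E) (h : E → F → ℝ) (hy : E → F → F),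
    V ∈ 𝓝 y₀ ∧ IsCompact Z ∧ Z.Nonempty ∧
    ContinuousOn (fun p : E × F => h p.1 p.2) (Z ×ˢ V) ∧
    ContinuousOn (fun p : E × F => hy p.1 p.2) (Z ×ˢ V) ∧
    (∀ x ∈ Z, ∀ y ∈ V, HasGradientAt (h x) (hy x y) y) ∧
    ∀ y ∈ V, (∃ x ∈ Z, φ y = h x y) ∧ ∀ x ∈ Z, h x y ≤ φ y

/-- Envelope theorem: if the increments of `f` at `y` are squeezed between increments of `Ψ` in its
second argument, with the first argument frozen at `p y` below and at `p z` above, then `f` inherits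
the partial derivative of `Ψ`. -/
theorem HasStrictFDerivAt.hasFDerivAt_of_increment_bounds
    {E F : Type*} [NormedAddCommGroup E] [NormedSpace ℝ E] [NormedAddCommGroup F] [NormedSpace ℝ F]
    {Ψ : E × F → ℝ} {Ψ' : E × F →L[ℝ] ℝ} {p : F → E} {f : F → ℝ} {y : F}
    (hΨ : HasStrictFDerivAt Ψ Ψ' (p y, y)) (hp : ContinuousAt p y)
    (hlo : ∀ᶠ z in 𝓝 y, Ψ (p y, z) - Ψ (p y, y) ≤ f z - f y)
    (hhi : ∀ᶠ z in 𝓝 y, f z - f y ≤ Ψ (p z, z) - Ψ (p z, y)) :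
    HasFDerivAt f (Ψ'.comp (ContinuousLinearMap.inr ℝ E F)) y := by
  have frozen : ∀ q : F → E, ContinuousAt q y → q y = p y →
      (fun z => Ψ (q z, z) - Ψ (q z, y) - Ψ' (0, z - y)) =o[𝓝 y] fun z => z - y := by
    intro q hq hqy
    have ht : Tendsto (fun z => ((q z, z), (q z, y))) (𝓝 y) (𝓝 ((p y, y), (p y, y))) := by
      rw [← hqy]
      exact (hq.prodMk continuousAt_id).prodMk (hq.prodMk continuousAt_const)
    refine ((hΨ.isLittleO.comp_tendsto ht).trans_isBigO ?_).congr_left fun z => ?_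
    · exact Asymptotics.isBigO_of_le _ fun z => by simp
    · simp [-map_sub]
  refine HasFDerivAt.of_isLittleO (Asymptotics.isLittleO_iff.2 fun c hc => ?_)
  filter_upwards [hlo, hhi, (frozen (fun _ => p y) continuousAt_const rfl).def hc,
    (frozen p hp rfl).def hc] with z h₁ h₂ h₃ h₄
  simp only [ContinuousLinearMap.comp_apply, ContinuousLinearMap.inr_apply, Real.norm_eq_abs,
    abs_le] at h₃ h₄ ⊢
  constructor <;> linarith

theorem grady_eq_toDual_symm
    {E F : Type*} [NormedAddCommGroup E] [NormedSpace ℝ E]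
    [NormedAddCommGroup F] [InnerProductSpace ℝ F] [CompleteSpace F]
    {Φ : E → F → ℝ} {Φ' : E × F →L[ℝ] ℝ} {x : E} {y : F}
    (h : HasStrictFDerivAt (fun q : E × F => Φ q.1 q.2) Φ' (x, y)) :
    grady Φ x y =
      (InnerProductSpace.toDual ℝ F).symm (Φ'.comp (ContinuousLinearMap.inr ℝ E F)) :=
  (h.hasFDerivAt.comp y (hasFDerivAt_prodMk_right x y)).hasGradientAt.gradient

theorem continuousOn_grady
    {E F : Type*} [NormedAddCommGroup E] [NormedSpace ℝ E]
    [NormedAddCommGroup F] [InnerProductSpace ℝ F] [CompleteSpace F]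
    {Φ : E → F → ℝ} {O : Set (E × F)} (hO : IsOpen O)
    (hΦ : ContDiffOn ℝ 1 (fun q : E × F => Φ q.1 q.2) O) :
    ContinuousOn (fun q : E × F => grady Φ q.1 q.2) O := by
  have hd := hΦ.continuousOn_fderiv_of_isOpen hO le_rfl
  refine ContinuousOn.congr (f := fun q => (InnerProductSpace.toDual ℝ F).symm
    ((fderiv ℝ (fun q : E × F => Φ q.1 q.2) q).comp (ContinuousLinearMap.inr ℝ E F))) ?_ ?_
  · exact (InnerProductSpace.toDual ℝ F).symm.continuous.comp_continuousOn
      (hd.clm_comp continuousOn_const)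
  · exact fun q hq => grady_eq_toDual_symm
      ((hΦ.contDiffAt (hO.mem_nhds hq)).hasStrictFDerivAt one_ne_zero)

theorem lowerSemicontinuousOn_sub_coupling
    {E F : Type*} [TopologicalSpace E] [TopologicalSpace F]
    {X : Set E} {Y : Set F} {Φ : E → F → ℝ} {g : E → EReal}
    (hΦ : ContinuousOn (fun q : E × F => Φ q.1 q.2) (X ×ˢ Y)) (hg : LowerSemicontinuousOn g X) :
    LowerSemicontinuousOn (fun q : E × F => g q.1 - (Φ q.1 q.2 : EReal)) (X ×ˢ Y) := by
  simp only [sub_eq_add_neg]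
  refine LowerSemicontinuousOn.add' ?_ ?_ fun q _ => EReal.continuousAt_add ?_ ?_
  · exact hg.comp continuous_fst.continuousOn fun q hq => hq.1
  · refine ContinuousOn.lowerSemicontinuousOn ?_
    exact continuous_neg.comp_continuousOn (continuous_coe_real_ereal.comp_continuousOn hΦ)
  · exact .inr (by simp [← EReal.coe_neg])
  · exact .inr (by simp [← EReal.coe_neg])

theorem mem_proxSet_ne_top
    {E F : Type*} {X : Set E} {Φ : E → F → ℝ} {g : E → EReal} {x : E} {y : F}
    (hg : ∃ x ∈ X, g x ≠ ⊤) (hx : x ∈ proxSet X Φ g y) : g x ≠ ⊤ := by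
  obtain ⟨x₀, hx₀, hfin⟩ := hg
  intro htop
  have h := hx.2 x₀ hx₀
  rw [htop, EReal.top_sub_coe, top_le_iff] at h
  induction hgx : g x₀ <;> simp_all [← EReal.coe_sub]

theorem phiConj_eq_of_mem_proxSet
    {E F : Type*} {X : Set E} {Φ : E → F → ℝ} {g : E → EReal} {x : E} {y : F}
    (hbot : ∀ x, g x ≠ ⊥) (htop : g x ≠ ⊤) (hx : x ∈ proxSet X Φ g y) :
    phiConj X Φ g y = ((Φ x y - (g x).toReal : ℝ) : EReal) := by
  have hgx : (Φ x y : EReal) - g x = ((Φ x y - (g x).toReal : ℝ) : EReal) := by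
    rw [EReal.coe_sub, EReal.coe_toReal htop (hbot x)]
  rw [← hgx]
  refine le_antisymm (iSup₂_le fun x' hx' => ?_) (le_iSup₂_of_le x hx.1 le_rfl)
  have h := EReal.neg_le_neg_iff.2 (hx.2 x' hx')
  rwa [EReal.neg_sub (by simp) (by simp), EReal.neg_sub (by simp) (by simp), add_comm,
    ← sub_eq_add_neg, add_comm, ← sub_eq_add_neg] at h

namespace AssumptionG

variable {E F : Type*} [NormedAddCommGroup E] [NormedAddCommGroup F]
  {X : Set E} {Y : Set F} {Φ : E → F → ℝ} {g : E → EReal}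

theorem proxSet_nonempty [ProperSpace E] (hG : AssumptionG X Y Φ g) (hX : IsClosed X)
    (hΦ : ContinuousOn (fun q : E × F => Φ q.1 q.2) (X ×ˢ Y)) {y : F} (hy : y ∈ Y) :
    (proxSet X Φ g y).Nonempty := by
  obtain ⟨x₀, hx₀, hfin⟩ := hG.proper
  have hα : g x₀ - (Φ x₀ y : EReal) = (((g x₀).toReal - Φ x₀ y : ℝ) : EReal) := by
    rw [EReal.coe_sub, EReal.coe_toReal hfin (hG.ne_bot x₀)]
  obtain ⟨V, hV, B, hB, hsub⟩ := hG.levelBounded y hy ((g x₀).toReal - Φ x₀ y)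
  have hlevel := hsub y ⟨mem_of_mem_nhds hV, hy⟩
  rw [← hα] at hlevel
  have hlsc : LowerSemicontinuousOn (fun x => g x - (Φ x y : EReal)) (X ∩ closure B) :=
    (lowerSemicontinuousOn_sub_coupling hΦ hG.lsc).comp (g := fun x => (x, y))
      (by fun_prop) fun x hx => ⟨hx.1, hy⟩
  have hx₀B : x₀ ∈ X ∩ closure B := ⟨hx₀, subset_closure (hlevel ⟨hx₀, le_rfl⟩)⟩
  obtain ⟨a, ha, hmin⟩ :=
    hlsc.exists_isMinOn ⟨x₀, hx₀B⟩ (hB.isCompact_closure.inter_left hX)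
  refine ⟨a, ha.1, fun x hx => ?_⟩
  by_cases hxl : g x - (Φ x y : EReal) ≤ g x₀ - (Φ x₀ y : EReal)
  · exact hmin ⟨hx, subset_closure (hlevel ⟨hx, hxl⟩)⟩
  · exact (hmin hx₀B).trans (not_le.1 hxl).le

theorem mem_proxSet_of_mapClusterPt (hG : AssumptionG X Y Φ g)
    (hΦ : ContinuousOn (fun q : E × F => Φ q.1 q.2) (X ×ˢ Y)) {y : F} (hy : y ∈ Y)
    {p : F → E} (hp : ∀ᶠ z in 𝓝 y, z ∈ Y ∧ p z ∈ proxSet X Φ g z)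
    {x : E} (hx : x ∈ X) (hc : MapClusterPt x (𝓝 y) p) : x ∈ proxSet X Φ g y := by
  refine ⟨hx, fun x' hx' => not_lt.1 fun hlt => ?_⟩
  obtain ⟨c, hc₁, hc₂⟩ := EReal.lt_iff_exists_real_btwn.1 hlt
  have hbelow : ∀ᶠ q in 𝓝 (x, y), q ∈ X ×ˢ Y → (c : EReal) < g q.1 - (Φ q.1 q.2 : EReal) :=
    eventually_nhdsWithin_iff.1
      (lowerSemicontinuousOn_sub_coupling hΦ hG.lsc (x, y) ⟨hx, hy⟩ c hc₂)
  rw [nhds_prod_eq] at hbelow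
  obtain ⟨P, hP, Q, hQ, hPQ⟩ := eventually_prod_iff.1 hbelow
  have hYnhds : Y ∈ 𝓝 y := hp.mono fun _ h => h.1
  have hcont : ContinuousAt (fun z => (Φ x' z : EReal)) y :=
    continuous_coe_real_ereal.continuousAt.comp
      ((hΦ.comp (f := fun z => (x', z)) (by fun_prop) fun z hz => ⟨hx', hz⟩).continuousAt hYnhds)
  have habove : ∀ᶠ z in 𝓝 y, g x' - (Φ x' z : EReal) < c := by
    have h : ContinuousAt (fun z => g x' - (Φ x' z : EReal)) y := by
      simp only [sub_eq_add_neg]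
      exact ContinuousAt.comp (f := fun z => (g x', -(Φ x' z : EReal)))
        (EReal.continuousAt_add (.inr (by simp)) (.inr (by simp)))
        (continuousAt_const.prodMk (continuous_neg.continuousAt.comp hcont))
    exact h.eventually_lt_const hc₁
  obtain ⟨z, hzP, hz, hzQ, hzlt⟩ :=
    ((hc.frequently hP).and_eventually (hp.and (hQ.and habove))).exists
  exact lt_irrefl _ (((hPQ hzP hzQ ⟨hz.2.1, hz.1⟩).trans_le (hz.2.2 x' hx')).trans hzlt)

theorem continuousAt_of_proxSet_eq_singleton [ProperSpace E] (hG : AssumptionG X Y Φ g)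
    (hX : IsClosed X) (hΦ : ContinuousOn (fun q : E × F => Φ q.1 q.2) (X ×ˢ Y))
    {y : F} {p : F → E} (hp : ∀ᶠ z in 𝓝 y, z ∈ Y ∧ proxSet X Φ g z = {p z}) :
    ContinuousAt p y := by
  have hmem : ∀ᶠ z in 𝓝 y, z ∈ Y ∧ p z ∈ proxSet X Φ g z :=
    hp.mono fun z hz => ⟨hz.1, hz.2 ▸ mem_singleton _⟩
  have hy : y ∈ Y := hp.self_of_nhds.1
  obtain ⟨x₀, hx₀, hfin⟩ := hG.proper
  have hcont : ContinuousAt (fun z => (g x₀).toReal - Φ x₀ z) y :=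
    continuousAt_const.sub
      ((hΦ.comp (f := fun z => (x₀, z)) (by fun_prop) fun z hz => ⟨hx₀, hz⟩).continuousAt
        (hp.mono fun _ h => h.1))
  obtain ⟨V, hV, B, hB, hsub⟩ := hG.levelBounded y hy ((g x₀).toReal - Φ x₀ y + 1)
  refine (hB.isCompact_closure.inter_left hX).tendsto_nhds_of_unique_mapClusterPt ?_
    fun x hx hc => ?_
  · filter_upwards [hmem, hV, hcont.eventually_lt_const (lt_add_one _)] with z hz hzV hzlt
    refine ⟨hz.2.1, subset_closure (hsub z ⟨hzV, hz.1⟩ ⟨hz.2.1, (hz.2.2 x₀ hx₀).trans ?_⟩)⟩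
    rw [← EReal.coe_toReal hfin (hG.ne_bot x₀), ← EReal.coe_sub]
    exact EReal.coe_le_coe_iff.2 hzlt.le
  · have h := hG.mem_proxSet_of_mapClusterPt hΦ hy hmem hx.1 hc
    rwa [hp.self_of_nhds.2, mem_singleton_iff] at h

theorem phiConj_toReal_sub_le (hG : AssumptionG X Y Φ g) {x x' : E} {y y' : F}
    (hx : x ∈ proxSet X Φ g y) (hx' : x' ∈ proxSet X Φ g y') :
    (phiConj X Φ g y).toReal - (phiConj X Φ g y').toReal ≤ Φ x y - Φ x y' := by
  have ht := mem_proxSet_ne_top hG.proper hx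
  have ht' := mem_proxSet_ne_top hG.proper hx'
  have h := hx'.2 x hx.1
  rw [← EReal.coe_toReal ht (hG.ne_bot x), ← EReal.coe_toReal ht' (hG.ne_bot x'),
    ← EReal.coe_sub, ← EReal.coe_sub, EReal.coe_le_coe_iff] at h
  rw [phiConj_eq_of_mem_proxSet hG.ne_bot ht hx, phiConj_eq_of_mem_proxSet hG.ne_bot ht' hx',
    EReal.toReal_coe, EReal.toReal_coe]
  linarith

end AssumptionG

theorem phi_conjugate_continuously_differentiable {n m : ℕ}
    (X : Set (EuclideanSpace ℝ (Fin n))) (Y : Set (EuclideanSpace ℝ (Fin m)))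
    (Φ : EuclideanSpace ℝ (Fin n) → EuclideanSpace ℝ (Fin m) → ℝ)
    (hXcl : IsClosed X) (hXint : (interior X).Nonempty)
    (hYne : Y.Nonempty) (hYop : IsOpen Y)
    (hΦc : ContinuousOn (fun p : (EuclideanSpace ℝ (Fin n)) × (EuclideanSpace ℝ (Fin m)) => Φ p.1 p.2) (X ×ˢ Y))
    (hΦd : ContDiffOn ℝ 1 (fun p : (EuclideanSpace ℝ (Fin n)) × (EuclideanSpace ℝ (Fin m)) => Φ p.1 p.2) ((interior X) ×ˢ Y))
    (g : EuclideanSpace ℝ (Fin n) → EReal) (hG : AssumptionG X Y Φ g)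
    (xb : EuclideanSpace ℝ (Fin n)) (hxb : xb ∈ interior X) (hfin : g xb ≠ ⊤ ∧ g xb ≠ ⊥)
    (yb : EuclideanSpace ℝ (Fin m)) (hyb : yb ∈ Y) (hprox : proxSet X Φ g yb = {xb})
    (hsv : ∃ U0 ∈ 𝓝 yb, ∀ y ∈ U0, (proxSet X Φ g y).Subsingleton) :
    ∃ U ∈ 𝓝 yb, ∃ p : EuclideanSpace ℝ (Fin m) → EuclideanSpace ℝ (Fin n),
      (∀ y ∈ U, proxSet X Φ g y = {p y}) ∧
      (∀ y ∈ U, HasGradientAt (fun y' => (phiConj X Φ g y').toReal) (grady Φ (p y) y) y) ∧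
      ContinuousOn (fun y => grady Φ (p y) y) U := by
  obtain ⟨U₀, hU₀, hsing⟩ := hsv
  obtain ⟨W, hWU, hWop, hybW⟩ := _root_.mem_nhds_iff.1 hU₀
  have hUop : IsOpen (W ∩ Y) := hWop.inter hYop
  choose! p hp using fun y (hy : y ∈ Y) => hG.proxSet_nonempty hXcl hΦc hy
  have hps : ∀ y ∈ W ∩ Y, proxSet X Φ g y = {p y} := fun y hy =>
    (hsing y (hWU hy.1)).eq_singleton_of_mem (hp y hy.2)
  have hpc : ∀ y ∈ W ∩ Y, ContinuousAt p y := fun y hy =>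
    hG.continuousAt_of_proxSet_eq_singleton hXcl hΦc
      ((hUop.eventually_mem hy).mono fun z hz => ⟨hz.2, hps z hz⟩)
  have hOop : IsOpen (interior X ×ˢ Y) := isOpen_interior.prod hYop
  have hmaps : ∀ y ∈ W ∩ Y, (p y, y) ∈ interior X ×ˢ Y := fun y hy =>
    ⟨hG.ran_interior y hy.2 (hp y hy.2), hy.2⟩
  refine ⟨W ∩ Y, hUop.mem_nhds ⟨hybW, hyb⟩, p, hps, fun y hy => ?_, ?_⟩
  · have hstrict :=
      (hΦd.contDiffAt (hOop.mem_nhds (hmaps y hy))).hasStrictFDerivAt one_ne_zero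
    rw [grady_eq_toDual_symm hstrict]
    refine HasFDerivAt.hasGradientAt
      (hstrict.hasFDerivAt_of_increment_bounds (hpc y hy) ?_ ?_)
    · filter_upwards [hUop.mem_nhds hy] with z hz
      linarith [hG.phiConj_toReal_sub_le (hp y hy.2) (hp z hz.2)]
    · filter_upwards [hUop.mem_nhds hy] with z hz
      exact hG.phiConj_toReal_sub_le (hp z hz.2) (hp y hy.2)
  · exact (continuousOn_grady hOop hΦd).comp (f := fun y => (p y, y))
      (fun y hy => ((hpc y hy).prodMk continuousAt_id).continuousWithinAt) hmaps

end
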